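/- arXiv:2403.07748 — 5 statements merged into one kernel-verified Lean document; each statement's English description precedes it below -/
import Mathlib

section
/- Every execution of Trémaux's depth-first search algorithm is finite; it stops with the agent at the origin r after exactly 2m moves, and each dart of G is traversed exactly once, i.e., each edge is traversed exactly once in each direction. -/
/-!
Trémaux's depth-first search.  A dart of `G` is an ordered pair of adjacent
vertices.  Markers: `none` (unmarked), `E` (Explored), `B` (Backtrack),
`F` (First entry).  A state records the marking, the agent's position and
the set of visited vertices.
-/

namespace Tremaux

inductive Mk : Type
  | none | E | B | F
  deriving DecidableEq

structure St (V : Type*) where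
  μ : V → V → Mk
  pos : V
  vis : Set V

variable {V : Type*} [DecidableEq V]

/-- Update the marker of the dart `(u, v)`. -/
def upd (μ : V → V → Mk) (u v : V) (c : Mk) : V → V → Mk :=
  fun a b => if a = u ∧ b = v then c else μ a b

/-- One move of the agent, applying the first applicable rule (T1)–(T3);
the label records the traversed dart. -/
inductive Step (G : SimpleGraph V) : St V → V × V → St V → Prop
  | t1 (s : St V) (v : V) (hadj : G.Adj s.pos v)
      (hB : s.μ s.pos v = Mk.B) :
      Step G s (s.pos, v) ⟨upd s.μ s.pos v Mk.E, v, s.vis⟩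
  | t2_new (s : St V) (v : V) (hadj : G.Adj s.pos v)
      (hnoB : ∀ w, G.Adj s.pos w → s.μ s.pos w ≠ Mk.B)
      (h0 : s.μ s.pos v = Mk.none) (hv : v ∉ s.vis) :
      Step G s (s.pos, v)
        ⟨upd (upd s.μ s.pos v Mk.E) v s.pos Mk.F, v, insert v s.vis⟩
  | t2_old (s : St V) (v : V) (hadj : G.Adj s.pos v)
      (hnoB : ∀ w, G.Adj s.pos w → s.μ s.pos w ≠ Mk.B)
      (h0 : s.μ s.pos v = Mk.none) (hv : v ∈ s.vis) :
      Step G s (s.pos, v)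
        ⟨upd (upd s.μ s.pos v Mk.E) v s.pos Mk.B, v, insert v s.vis⟩
  | t3 (s : St V) (v : V) (hadj : G.Adj s.pos v)
      (hnoB : ∀ w, G.Adj s.pos w → s.μ s.pos w ≠ Mk.B)
      (hno0 : ∀ w, G.Adj s.pos w → s.μ s.pos w ≠ Mk.none)
      (hF : s.μ s.pos v = Mk.F) :
      Step G s (s.pos, v) ⟨s.μ, v, s.vis⟩

/-- The initial state at the origin `r`. -/
def init (r : V) : St V := ⟨fun _ _ => Mk.none, r, {r}⟩

/-- `f 0, …, f k` is an execution of Trémaux's algorithm from the origin `r`,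
where the `i`-th move traverses the dart `d i`. -/
def IsExec (G : SimpleGraph V) (r : V) (k : ℕ) (f : ℕ → St V) (d : ℕ → V × V) : Prop :=
  f 0 = init r ∧ ∀ i < k, Step G (f i) (d i) (f (i + 1))

end Tremaux

namespace Tremaux

/-- `Link l u v` says that `v` immediately follows `u` somewhere in the list `l`. -/
def Link {V : Type*} : List V → V → V → Prop
  | [], _, _ => False
  | a :: l, u, v => (u = a ∧ l.head? = some v) ∨ Link l u v

theorem Link.mem {V : Type*} {l : List V} {u v : V} (h : Link l u v) : u ∈ l ∧ v ∈ l := by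
  induction l with
  | nil => exact h.elim
  | cons a l ih =>
    rcases h with ⟨rfl, h⟩ | h
    · exact ⟨by simp, List.mem_cons_of_mem _ (List.mem_of_head? h)⟩
    · exact ⟨List.mem_cons_of_mem _ (ih h).1, List.mem_cons_of_mem _ (ih h).2⟩

/-- The invariant of Trémaux's algorithm at a state with no backtracking pending. Here `s.pos :: l`
is the tree path from the agent's position back to the origin, and `T` is the set of darts
traversed so far. -/
structure Inv {V : Type*} (G : SimpleGraph V) (r : V) (s : St V) (l : List V)
    (T : Set (V × V)) : Prop where
  last : (s.pos :: l).getLast? = some r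
  nodup : (s.pos :: l).Nodup
  vis : ∀ x ∈ s.pos :: l, x ∈ s.vis
  link_F : ∀ u v, Link (s.pos :: l) u v → s.μ u v = Mk.F ∧ G.Adj u v
  F_link : ∀ u v, u ∈ s.pos :: l → s.μ u v = Mk.F → Link (s.pos :: l) u v
  none_symm : ∀ u v, s.μ u v = Mk.none → s.μ v u = Mk.none
  traversed : ∀ u v, (u, v) ∈ T ↔
    G.Adj u v ∧ s.μ u v ≠ Mk.none ∧ ¬ Link (s.pos :: l) u v
  retired : ∀ u v, u ∈ s.vis → u ∉ s.pos :: l → G.Adj u v → s.μ u v ≠ Mk.none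
  unvisited : ∀ u v, u ∉ s.vis → s.μ u v = Mk.none
  no_B : ∀ u v, s.μ u v ≠ Mk.B

/-- The state reached by entering the visited vertex `v` along an unmarked dart. -/
def bounce {V : Type*} [DecidableEq V] (s : St V) (v : V) : St V :=
  ⟨upd (upd s.μ s.pos v Mk.E) v s.pos Mk.B, v, insert v s.vis⟩

/-- The invariant of Trémaux's algorithm: either no backtracking is pending, or the agent has
just entered a visited vertex. -/
def Good {V : Type*} [DecidableEq V] (G : SimpleGraph V) (r : V) (s : St V)
    (T : Set (V × V)) : Prop :=
  (∃ l, Inv G r s l T) ∨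
  ∃ s₀ l T₀ v, Inv G r s₀ l T₀ ∧ G.Adj s₀.pos v ∧ s₀.μ s₀.pos v = Mk.none ∧ v ∈ s₀.vis ∧
    s = bounce s₀ v ∧ T = insert (s₀.pos, v) T₀

section

variable {V : Type*} {G : SimpleGraph V} {r : V} {s : St V} {l : List V} {T : Set (V × V)}

theorem Inv.init (G : SimpleGraph V) (r : V) : Inv G r (init r) [] ∅ := by
  constructor <;> simp +contextual [Tremaux.init, Link]

theorem Inv.retreat {v : V} (h : Inv G r s (v :: l) T)
    (hno0 : ∀ w, G.Adj s.pos w → s.μ s.pos w ≠ Mk.none) :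
    Inv G r ⟨s.μ, v, s.vis⟩ l (insert (s.pos, v) T) := by
  have hlink : ∀ a b, Link (s.pos :: v :: l) a b ↔
      (a = s.pos ∧ b = v) ∨ Link (v :: l) a b := by
    intro a b
    simp [Link, eq_comm]
  have hmem : ∀ a b, Link (v :: l) a b → a ∈ v :: l ∧ b ∈ v :: l := fun a b => Link.mem
  obtain ⟨h1, h2, h3, h4, h5, h6, h7, h8, h9, h10⟩ := h
  have hp : s.pos ∉ v :: l := (List.nodup_cons.1 h2).1
  constructor
  · simpa using h1
  · exact (List.nodup_cons.1 h2).2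
  · exact fun x hx => h3 x (List.mem_cons_of_mem _ hx)
  · grind
  · grind
  · exact h6
  · simp only [Set.mem_insert_iff, Prod.mk.injEq]; grind
  · grind
  · exact h9
  · exact h10

theorem Inv.exists_cons_of_F {v : V} (h : Inv G r s l T) (hF : s.μ s.pos v = Mk.F) :
    ∃ l', l = v :: l' := by
  rcases h.F_link _ _ (by simp) hF with ⟨-, h'⟩ | h'
  · exact ⟨_, (List.cons_head?_tail h').symm⟩
  · exact absurd h'.mem.1 (List.nodup_cons.1 h.nodup).1

variable [DecidableEq V]

theorem Inv.enter {v : V} (h : Inv G r s l T) (hadj : G.Adj s.pos v)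
    (h0 : s.μ s.pos v = Mk.none) (hv : v ∉ s.vis) :
    Inv G r ⟨upd (upd s.μ s.pos v Mk.E) v s.pos Mk.F, v, insert v s.vis⟩ (s.pos :: l)
      (insert (s.pos, v) T) := by
  have hne : s.pos ≠ v := hadj.ne
  have hvl : v ∉ s.pos :: l := fun hm => hv (h.vis v hm)
  have hlink : ∀ a b, Link (v :: s.pos :: l) a b ↔
      (a = v ∧ b = s.pos) ∨ Link (s.pos :: l) a b := by
    intro a b
    simp [Link, eq_comm]
  have hmem : ∀ a b, Link (s.pos :: l) a b → a ∈ s.pos :: l ∧ b ∈ s.pos :: l :=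
    fun a b => Link.mem
  have h0' := h.none_symm _ _ h0
  have hsymm := hadj.symm
  obtain ⟨h1, h2, h3, h4, h5, h6, h7, h8, h9, h10⟩ := h
  constructor
  · simpa using h1
  · exact List.nodup_cons.2 ⟨hvl, h2⟩
  · grind
  · simp only [hlink, upd]; grind
  · simp only [hlink, upd]; grind
  · simp only [upd]; grind
  · simp only [hlink, upd, Set.mem_insert_iff, Prod.mk.injEq]; grind
  · simp only [upd]; grind
  · simp only [upd]; grind
  · simp only [upd]; grind

theorem Inv.bounce_back {v : V} (h : Inv G r s l T) (hadj : G.Adj s.pos v)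
    (h0 : s.μ s.pos v = Mk.none) (hv : v ∈ s.vis) :
    Inv G r ⟨upd (bounce s v).μ v s.pos Mk.E, s.pos, insert v s.vis⟩ l
      (insert (v, s.pos) (insert (s.pos, v) T)) := by
  have hne : s.pos ≠ v := hadj.ne
  have h0' := h.none_symm _ _ h0
  have hsymm := hadj.symm
  have hvis : insert v s.vis = s.vis := Set.insert_eq_of_mem hv
  obtain ⟨h1, h2, h3, h4, h5, h6, h7, h8, h9, h10⟩ := h
  have hpos := h3 s.pos (by simp)
  rw [hvis]
  constructor
  · exact h1
  · exact h2
  · exact h3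
  · simp only [upd, bounce]; grind
  · simp only [upd, bounce]; grind
  · simp only [upd, bounce]; grind
  · simp only [upd, bounce, Set.mem_insert_iff, Prod.mk.injEq]; grind
  · simp only [upd, bounce]; grind
  · simp only [upd, bounce]; grind
  · simp only [upd, bounce]; grind

theorem Good.step {p : V × V} {s' : St V} (h : Good G r s T) (hs : Step G s p s') :
    p ∉ T ∧ G.Adj p.1 p.2 ∧ Good G r s' (insert p T) := by
  rcases h with ⟨l, h⟩ | ⟨s₀, l, T₀, v, h, hadj, h0, hv, rfl, rfl⟩
  · cases hs with
    | t1 v hadj hB => exact absurd hB (h.no_B _ _)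
    | t2_new v hadj hnoB h0 hv =>
      exact ⟨fun hT => ((h.traversed _ _).1 hT).2.1 h0, hadj, .inl ⟨_, h.enter hadj h0 hv⟩⟩
    | t2_old v hadj hnoB h0 hv =>
      exact ⟨fun hT => ((h.traversed _ _).1 hT).2.1 h0, hadj,
        .inr ⟨s, l, T, v, h, hadj, h0, hv, rfl, rfl⟩⟩
    | t3 v hadj hnoB hno0 hF =>
      obtain ⟨l', rfl⟩ := h.exists_cons_of_F hF
      exact ⟨fun hT => ((h.traversed _ _).1 hT).2.2 (h.F_link _ _ (by simp) hF), hadj,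
        .inl ⟨l', h.retreat hno0⟩⟩
  · have hB : (bounce s₀ v).μ v s₀.pos = Mk.B := by simp [bounce, upd]
    cases hs with
    | t1 w hadj' hB' =>
      have hw : w = s₀.pos := by
        by_contra hw
        have := h.no_B v w
        have hne := hadj.ne
        simp only [bounce, upd] at hB'
        grind
      subst hw
      refine ⟨?_, hadj.symm, .inl ⟨l, h.bounce_back hadj h0 hv⟩⟩
      rintro (hT | hT)
      · exact hadj.ne (Prod.mk.inj hT).2
      · exact ((h.traversed _ _).1 hT).2.1 (h.none_symm _ _ h0)
    | t2_new w _ hnoB => exact absurd hB (hnoB _ hadj.symm)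
    | t2_old w _ hnoB => exact absurd hB (hnoB _ hadj.symm)
    | t3 w _ hnoB => exact absurd hB (hnoB _ hadj.symm)

theorem Good.of_terminal (hG : G.Connected) (h : Good G r s T) (hmax : ∀ p s', ¬ Step G s p s') :
    s.pos = r ∧ ∀ u v, G.Adj u v → (u, v) ∈ T := by
  rcases h with ⟨l, h⟩ | ⟨s₀, l, T₀, v, h, hadj, h0, hv, rfl, rfl⟩
  · have hnoB : ∀ w, G.Adj s.pos w → s.μ s.pos w ≠ Mk.B := fun w _ => h.no_B _ _
    have hno0 : ∀ w, G.Adj s.pos w → s.μ s.pos w ≠ Mk.none := by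
      intro w hw h0
      by_cases hv : w ∈ s.vis
      · exact hmax _ _ (.t2_old s w hw hnoB h0 hv)
      · exact hmax _ _ (.t2_new s w hw hnoB h0 hv)
    have hl : l = [] := by
      rcases l with _ | ⟨v, l⟩
      · rfl
      · obtain ⟨hF, hadj⟩ := h.link_F s.pos v (.inl ⟨rfl, rfl⟩)
        exact (hmax _ _ (.t3 s v hadj hnoB hno0 hF)).elim
    subst hl
    have hmark : ∀ u v, u ∈ s.vis → G.Adj u v → s.μ u v ≠ Mk.none := by
      intro u v hu huv
      by_cases hup : u = s.pos
      · subst hup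
        exact hno0 v huv
      · exact h.retired u v hu (by simpa using hup) huv
    have hwalk : ∀ u v, G.Walk u v → v ∈ s.vis → u ∈ s.vis := by
      intro u v w hv
      induction w with
      | nil => exact hv
      | cons hadj _ ih =>
        by_contra hu
        exact hmark _ _ (ih hv) hadj.symm (h.none_symm _ _ (h.unvisited _ _ hu))
    have hvis : ∀ u, u ∈ s.vis := by
      intro u
      obtain ⟨w⟩ := hG.preconnected u s.pos
      exact hwalk u s.pos w (h.vis _ (by simp))
    refine ⟨by simpa using h.last, fun u v huv =>
      (h.traversed u v).2 ⟨huv, hmark u v (hvis u) huv, ?_⟩⟩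
    simp [Link]
  · exact (hmax _ _ (.t1 (bounce s₀ v) s₀.pos hadj.symm (by simp [bounce, upd]))).elim

theorem good_of_steps {k : ℕ} {f : ℕ → St V} {d : ℕ → V × V} (h0 : f 0 = Tremaux.init r)
    (hs : ∀ i < k, Step G (f i) (d i) (f (i + 1))) {i : ℕ} (hi : i ≤ k) :
    Good G r (f i) (d '' Set.Iio i) := by
  induction i with
  | zero =>
    have hinit : Good G r (Tremaux.init r) ∅ := Or.inl ⟨[], Inv.init G r⟩
    simpa [h0] using hinit
  | succ i ih =>
    have := ((ih (by omega)).step (hs i hi)).2.2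
    have hIio : Set.Iio (i + 1) = insert i (Set.Iio i) := by
      ext
      simp
    rwa [← Set.image_insert_eq, ← hIio] at this

theorem IsExec.injOn {k : ℕ} {f : ℕ → St V} {d : ℕ → V × V} (h : IsExec G r k f d) :
    Set.InjOn d (Set.Iio k) := by
  have key : ∀ i j, i < j → j < k → d i ≠ d j := fun i j hij hj he =>
    ((good_of_steps h.1 h.2 hj.le).step (h.2 j hj)).1 ⟨i, hij, he⟩
  intro i hi j hj he
  rcases lt_trichotomy i j with hij | hij | hij
  · exact (key i j hij hj he).elim
  · exact hij
  · exact (key j i hij hi he.symm).elim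

theorem IsExec.adj {k : ℕ} {f : ℕ → St V} {d : ℕ → V × V} (h : IsExec G r k f d) {i : ℕ}
    (hi : i < k) : G.Adj (d i).1 (d i).2 :=
  ((good_of_steps h.1 h.2 hi.le).step (h.2 i hi)).2.1

end

end Tremaux

open Tremaux in
/-- Every execution of Trémaux's depth-first search is finite;
every maximal execution stops with the agent at the origin `r` after exactly
`2 * m` moves, and each dart of `G` is traversed exactly once. -/
theorem tremaux_exploration {V : Type*} [Fintype V] [DecidableEq V]
    (G : SimpleGraph V) [Fintype G.edgeSet] (hG : G.Connected) (r : V) :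
    (¬ ∃ (f : ℕ → St V) (d : ℕ → V × V),
        f 0 = init r ∧ ∀ i, Step G (f i) (d i) (f (i + 1))) ∧
    (∀ (k : ℕ) (f : ℕ → St V) (d : ℕ → V × V),
        IsExec G r k f d → (∀ p s', ¬ Step G (f k) p s') →
        k = 2 * G.edgeFinset.card ∧ (f k).pos = r ∧
        ∀ u v : V, G.Adj u v → ∃! i, i < k ∧ d i = (u, v)) := by
  classical
  refine ⟨?_, fun k f d h hmax => ?_⟩
  · rintro ⟨f, d, h0, hs⟩
    refine not_injective_infinite_finite d fun i j he => ?_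
    exact IsExec.injOn (k := i + j + 1) ⟨h0, fun i _ => hs i⟩ (Set.mem_Iio.2 (by omega))
      (Set.mem_Iio.2 (by omega)) he
  · obtain ⟨hpos, hall⟩ := (good_of_steps h.1 h.2 le_rfl).of_terminal hG hmax
    refine ⟨?_, hpos, fun u v huv => ?_⟩
    · have hbij : Function.Bijective
          (fun i : Fin k => (⟨d i, h.adj i.2⟩ : G.Dart)) := by
        constructor
        · intro i j he
          exact Fin.ext (h.injOn i.2 j.2 (congrArg SimpleGraph.Dart.toProd he))
        · rintro ⟨⟨u, v⟩, huv⟩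
          obtain ⟨i, hi, he⟩ := hall u v huv
          exact ⟨⟨i, hi⟩, SimpleGraph.Dart.ext _ _ he⟩
      have hcard := Fintype.card_of_bijective hbij
      rw [Fintype.card_fin, SimpleGraph.dart_card_eq_twice_card_edges] at hcard
      convert hcard
    · obtain ⟨i, hi, he⟩ := hall u v huv
      exact ⟨i, ⟨hi, he⟩, fun j hj => h.injOn hj.1 hi (hj.2.trans he.symm)⟩
end

section
/- In every execution of Trémaux's depth-first search algorithm, no dart is traversed twice; that is, no edge is ever traversed twice in the same direction. Consequently every execution consists of at most 2m moves. -/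
namespace Tremaux

section Invariant

variable {V : Type*}

theorem upd_eq_iff [DecidableEq V] (μ : V → V → Mk) (u v : V) (c e : Mk) (a b : V) :
    upd μ u v c a b = e ↔ (a = u ∧ b = v ∧ c = e) ∨ (¬(a = u ∧ b = v) ∧ μ a b = e) := by
  unfold upd
  split_ifs <;> tauto

/-- A stack of distinct vertices, topmost first, in which every dart marked `F` that leaves a
stack vertex leads to the vertex directly below it. -/
inductive IsStack (μ : V → V → Mk) : List V → Prop
  | root (r : V) (h : ∀ x, μ r x ≠ Mk.F) : IsStack μ [r]
  | push (u w : V) (l : List V) (hl : IsStack μ (w :: l)) (hu : u ∉ w :: l)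
      (h : ∀ x, μ u x = Mk.F → x = w) : IsStack μ (u :: w :: l)

theorem IsStack.mono {μ μ' : V → V → Mk} {l : List V} (hl : IsStack μ l)
    (h : ∀ a ∈ l, ∀ x, μ' a x = Mk.F → μ a x = Mk.F) : IsStack μ' l := by
  induction hl with
  | root r hr => exact .root r fun x hx => hr x (h r (by simp) x hx)
  | push u w l _ hu hF ih =>
    exact .push u w l (ih fun a ha => h a (List.mem_cons_of_mem _ ha)) hu
      fun x hx => hF x (h u (by simp) x hx)

/-- The depth-first search invariant, for the stack `t :: l` of discovered but unfinished
vertices and the set `U` of darts traversed so far.  Either the agent is at the top of the stack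
and no dart is marked `B`, or the only such dart leads from the agent to the top of the stack. -/
structure Inv_s1 (G : SimpleGraph V) (s : St V) (t : V) (l : List V) (U : Set (V × V)) : Prop where
  none_symm : ∀ a b, s.μ a b = Mk.none → s.μ b a = Mk.none
  stack : IsStack s.μ (t :: l)
  stack_vis : ∀ a ∈ t :: l, a ∈ s.vis
  first_vis : ∀ a b, s.μ a b = Mk.F → a ∈ s.vis
  mode : (s.pos = t ∧ ∀ a b, s.μ a b ≠ Mk.B) ∨
    (G.Adj s.pos t ∧ s.μ s.pos t = Mk.B ∧ ∀ a b, s.μ a b = Mk.B → a = s.pos ∧ b = t)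
  used_none : ∀ a b, (a, b) ∈ U → s.μ a b ≠ Mk.none
  used_back : ∀ a b, (a, b) ∈ U → s.μ a b ≠ Mk.B
  used_first : ∀ a b, (a, b) ∈ U → s.μ a b = Mk.F → a ∉ t :: l

theorem inv_init [DecidableEq V] (G : SimpleGraph V) (r : V) : Inv_s1 G (init r) r [] ∅ where
  none_symm := by simp [init]
  stack := .root r (by simp [init])
  stack_vis := by simp [init]
  first_vis := by simp [init]
  mode := by simp [init]
  used_none := by simp
  used_back := by simp
  used_first := by simp

theorem Inv_s1.step [DecidableEq V] {G : SimpleGraph V} {s s' : St V} {d : V × V} {t : V}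
    {l : List V} {U : Set (V × V)} (hI : Inv_s1 G s t l U) (hs : Step G s d s') :
    G.Adj d.1 d.2 ∧ d ∉ U ∧ ∃ t' l', Inv_s1 G s' t' l' (insert d U) := by
  obtain ⟨hsymm, hst, hsv, hfv, hmode, hun, hub, huf⟩ := hI
  cases hs with
  | t1 v hadj hB =>
    refine ⟨hadj, fun h => hub _ _ h hB, t, l, ?_⟩
    obtain ⟨-, h⟩ | ⟨-, -, hB'⟩ := hmode
    · exact absurd hB (h _ _)
    obtain rfl : v = t := (hB' _ _ hB).2
    constructor <;> simp only [upd_eq_iff, ne_eq, Set.mem_insert_iff, Prod.mk.injEq]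
    · grind
    · exact hst.mono fun a _ x => by grind [upd]
    all_goals grind
  | t2_new v hadj hnoB h0 hv =>
    refine ⟨hadj, fun h => hun _ _ h h0, v, t :: l, ?_⟩
    obtain ⟨rfl, hB⟩ | ⟨hadj', hB, -⟩ := hmode
    swap
    · exact absurd hB (hnoB _ hadj')
    have hne := hadj.ne
    have h0' := hsymm _ _ h0
    have hvl : v ∉ s.pos :: l := fun h => hv (hsv v h)
    constructor <;> simp only [upd_eq_iff, ne_eq, Set.mem_insert_iff, Prod.mk.injEq]
    · grind
    · refine .push _ _ _ (hst.mono fun a ha x => ?_) hvl fun x => ?_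
      · grind [upd]
      · grind [upd]
    all_goals grind
  | t2_old v hadj hnoB h0 hv =>
    refine ⟨hadj, fun h => hun _ _ h h0, t, l, ?_⟩
    obtain ⟨rfl, hB⟩ | ⟨hadj', hB, -⟩ := hmode
    swap
    · exact absurd hB (hnoB _ hadj')
    have hne := hadj.ne
    have h0' := hsymm _ _ h0
    have hadj' := hadj.symm
    constructor <;> simp only [upd_eq_iff, ne_eq, Set.mem_insert_iff, Prod.mk.injEq]
    · grind
    · exact hst.mono fun a _ x => by grind [upd]
    all_goals grind
  | t3 v hadj hnoB hno0 hF =>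
    obtain ⟨rfl, hB⟩ | ⟨hadj', hB, -⟩ := hmode
    swap
    · exact absurd hB (hnoB _ hadj')
    refine ⟨hadj, fun h => huf _ _ h hF (by simp), ?_⟩
    cases hst with
    | root _ h => exact absurd hF (h v)
    | push _ w l hl hu h =>
      obtain rfl := h v hF
      refine ⟨v, l, ?_⟩
      constructor <;> simp only [ne_eq, Set.mem_insert_iff, Prod.mk.injEq]
      · exact hsymm
      · exact hl
      all_goals grind

theorem IsExec.exists_inv [DecidableEq V] {G : SimpleGraph V} {r : V} {k : ℕ} {f : ℕ → St V}
    {d : ℕ → V × V} (h : IsExec G r k f d) (i : ℕ) (hi : i ≤ k) :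
    ∃ t l, Inv_s1 G (f i) t l (d '' Set.Iio i) := by
  induction i with
  | zero =>
    refine ⟨r, [], ?_⟩
    have hU : Set.Iio (0 : ℕ) = ∅ := Set.Iio_bot
    rw [hU, Set.image_empty, h.1]
    exact inv_init G r
  | succ i ih =>
    obtain ⟨t, l, hI⟩ := ih (by omega)
    have hU : d '' Set.Iio (i + 1) = insert (d i) (d '' Set.Iio i) := by
      rw [← Set.image_insert_eq]
      congr 1
      ext j
      simp only [Set.mem_Iio, Set.mem_insert_iff]
      omega
    rw [hU]
    exact (hI.step (h.2 i hi)).2.2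

end Invariant

end Tremaux

open Tremaux in
/-- In every execution of Trémaux's algorithm no dart is
traversed twice (no edge is traversed twice in the same direction); hence
every execution consists of at most `2 * m` moves. -/
theorem tremaux_no_dart_twice {V : Type*} [Fintype V] [DecidableEq V]
    (G : SimpleGraph V) [Fintype G.edgeSet] (hG : G.Connected) (r : V) :
    ∀ (k : ℕ) (f : ℕ → St V) (d : ℕ → V × V),
      IsExec G r k f d →
      (∀ i j, i < k → j < k → d i = d j → i = j) ∧
      k ≤ 2 * G.edgeFinset.card := by
  intro k f d h
  have key : ∀ i < k, G.Adj (d i).1 (d i).2 ∧ d i ∉ d '' Set.Iio i := fun i hi => by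
    obtain ⟨t, l, hI⟩ := h.exists_inv i hi.le
    exact ⟨(hI.step (h.2 i hi)).1, (hI.step (h.2 i hi)).2.1⟩
  have inj : ∀ i j, i < k → j < k → d i = d j → i = j := by
    intro i j hi hj hij
    rcases lt_trichotomy i j with hlt | rfl | hlt
    · exact absurd ⟨i, hlt, hij⟩ (key j hj).2
    · rfl
    · exact absurd ⟨j, hlt, hij.symm⟩ (key i hi).2
  refine ⟨inj, ?_⟩
  classical
  have hcard : Fintype.card (Fin k) ≤ Fintype.card G.Dart :=
    Fintype.card_le_of_injective (fun i : Fin k => (⟨d i, (key i i.2).1⟩ : G.Dart))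
      fun i j hij => Fin.ext (inj i j i.2 j.2 (congrArg SimpleGraph.Dart.toProd hij))
  rw [Fintype.card_fin, G.dart_card_eq_twice_card_edges] at hcard
  convert hcard
end

section
/- Every maximal asynchronous execution of the two-agent exploration algorithm consists of exactly 2m moves in total; when it terminates, every edge of G has been traversed exactly twice and the two agents occupy the same vertex. -/
/-!
Two-agent asynchronous collective exploration.  Markers:
`none` (unmarked), `E` (Explored), `B` (Backtrack), `F` (First entry),
`D` (Done, traversed twice).  A state records the marking, the positions of
the two agents and the set of visited vertices.
-/

namespace TwoExplore

inductive Mk : Type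
  | none | E | B | F | D
  deriving DecidableEq

structure St (V : Type*) where
  μ : V → V → Mk
  p1 : V
  p2 : V
  vis : Set V

variable {V : Type*} [DecidableEq V]

/-- Update the marker of the dart `(u, v)`. -/
def upd (μ : V → V → Mk) (u v : V) (c : Mk) : V → V → Mk :=
  fun a b => if a = u ∧ b = v then c else μ a b

/-- Position of agent `b` (`true` = first agent, `false` = second agent). -/
def pos (s : St V) (b : Bool) : V := if b then s.p1 else s.p2

/-- The state obtained from `s` by moving agent `b` to `v`, with new marking
`μ'` and new visited set `vis'`. -/
def moveTo (s : St V) (b : Bool) (v : V) (μ' : V → V → Mk) (vis' : Set V) : St V :=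
  ⟨μ', if b then v else s.p1, if b then s.p2 else v, vis'⟩

/-- One asynchronous move: agent `b` applies the first applicable rule
(R1)–(R5); the label records the agent and the traversed dart. -/
inductive Step (G : SimpleGraph V) : St V → Bool × (V × V) → St V → Prop
  | r1 (s : St V) (b : Bool) (v : V) (hadj : G.Adj (pos s b) v)
      (hB : s.μ (pos s b) v = Mk.B) :
      Step G s (b, (pos s b, v))
        (moveTo s b v (upd (upd s.μ (pos s b) v Mk.D) v (pos s b) Mk.D) s.vis)
  | r2 (s : St V) (b : Bool) (v : V) (hadj : G.Adj (pos s b) v)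
      (hnoB : ∀ w, G.Adj (pos s b) w → s.μ (pos s b) w ≠ Mk.B)
      (h0 : s.μ (pos s b) v = Mk.none) (hE : s.μ v (pos s b) = Mk.E) :
      Step G s (b, (pos s b, v))
        (moveTo s b v (upd (upd s.μ (pos s b) v Mk.E) v (pos s b) Mk.D) s.vis)
  | r3_new (s : St V) (b : Bool) (v : V) (hadj : G.Adj (pos s b) v)
      (hnoB : ∀ w, G.Adj (pos s b) w → s.μ (pos s b) w ≠ Mk.B)
      (hnoRev : ∀ w, G.Adj (pos s b) w →
        ¬(s.μ (pos s b) w = Mk.none ∧ s.μ w (pos s b) = Mk.E))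
      (h0 : s.μ (pos s b) v = Mk.none) (hv : v ∉ s.vis) :
      Step G s (b, (pos s b, v))
        (moveTo s b v (upd (upd s.μ (pos s b) v Mk.E) v (pos s b) Mk.F)
          (insert v s.vis))
  | r3_old (s : St V) (b : Bool) (v : V) (hadj : G.Adj (pos s b) v)
      (hnoB : ∀ w, G.Adj (pos s b) w → s.μ (pos s b) w ≠ Mk.B)
      (hnoRev : ∀ w, G.Adj (pos s b) w →
        ¬(s.μ (pos s b) w = Mk.none ∧ s.μ w (pos s b) = Mk.E))
      (h0 : s.μ (pos s b) v = Mk.none) (hv : v ∈ s.vis) :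
      Step G s (b, (pos s b, v))
        (moveTo s b v (upd (upd s.μ (pos s b) v Mk.E) v (pos s b) Mk.B)
          (insert v s.vis))
  | r4 (s : St V) (b : Bool) (v : V) (hadj : G.Adj (pos s b) v)
      (hnoB : ∀ w, G.Adj (pos s b) w → s.μ (pos s b) w ≠ Mk.B)
      (hno0 : ∀ w, G.Adj (pos s b) w → s.μ (pos s b) w ≠ Mk.none)
      (hF : s.μ (pos s b) v = Mk.F) :
      Step G s (b, (pos s b, v))
        (moveTo s b v (upd (upd s.μ (pos s b) v Mk.D) v (pos s b) Mk.D) s.vis)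
  | r5 (s : St V) (b : Bool) (v : V) (hadj : G.Adj (pos s b) v)
      (hnoB : ∀ w, G.Adj (pos s b) w → s.μ (pos s b) w ≠ Mk.B)
      (hno0 : ∀ w, G.Adj (pos s b) w → s.μ (pos s b) w ≠ Mk.none)
      (hnoF : ∀ w, G.Adj (pos s b) w → s.μ (pos s b) w ≠ Mk.F)
      (hE : s.μ (pos s b) v = Mk.E) :
      Step G s (b, (pos s b, v))
        (moveTo s b v (upd (upd s.μ (pos s b) v Mk.D) v (pos s b) Mk.D) s.vis)

/-- The initial state: both agents at the origin `r`. -/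
def init (r : V) : St V := ⟨fun _ _ => Mk.none, r, r, {r}⟩

/-- `f 0, …, f k` is an asynchronous execution, where at round `i` the
adversarially chosen agent `(lbl i).1` traverses the dart `(lbl i).2`. -/
def IsExec (G : SimpleGraph V) (r : V) (k : ℕ) (f : ℕ → St V)
    (lbl : ℕ → Bool × (V × V)) : Prop :=
  f 0 = init r ∧ ∀ i < k, Step G (f i) (lbl i) (f (i + 1))

/-- Number of times the edge `{u, v}` has been traversed (in either direction)
during the first `i` moves. -/
def edgeCount (lbl : ℕ → Bool × (V × V)) (i : ℕ) (u v : V) : ℕ :=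
  ((Finset.range i).filter fun j => (lbl j).2 = (u, v) ∨ (lbl j).2 = (v, u)).card

end TwoExplore

namespace TwoExplore

/-- How often the edge carrying a marker has been traversed. -/
def Mk.weight : Mk → ℕ
  | .none => 0
  | .E => 1
  | .B => 1
  | .F => 1
  | .D => 2

/-- Indicator of the markers of an edge traversed exactly once. -/
def Mk.single : Mk → ℕ
  | .none => 0
  | .E => 1
  | .B => 1
  | .F => 1
  | .D => 0

/-- Indicator of `Backtrack`. -/
def Mk.back : Mk → ℕ
  | .B => 1
  | _ => 0

/-- Indicator of `First entry`. -/
def Mk.first : Mk → ℕ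
  | .F => 1
  | _ => 0

/-- The pairs of markers that the two darts of an edge can carry. -/
def Mk.Compat : Mk → Mk → Prop
  | .none, .none => True
  | .E, .F => True
  | .E, .B => True
  | .F, .E => True
  | .B, .E => True
  | .D, .D => True
  | _, _ => False

/-- The sum of `g` over the markers at the darts leaving `x`. -/
def markSum {V : Type*} [Fintype V] (g : Mk → ℕ) (μ : V → V → Mk) (x : V) : ℕ :=
  ∑ w, g (μ x w)

/-- The marking after both darts of the edge `uv` have been re-marked. -/
def updEdge {V : Type*} [DecidableEq V] (μ : V → V → Mk) (u v : V) (c d : Mk) : V → V → Mk :=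
  upd (upd μ u v c) v u d

/-- The number of agents at `x`. -/
def agentsAt {V : Type*} [DecidableEq V] (s : St V) (x : V) : ℕ :=
  (if s.p1 = x then 1 else 0) + (if s.p2 = x then 1 else 0)

section Basic

variable {V : Type*} [DecidableEq V]

lemma agentsAt_moveTo (s : St V) (b : Bool) (v : V) (μ' : V → V → Mk) (W : Set V) (x : V) :
    agentsAt (moveTo s b v μ' W) x + (if pos s b = x then 1 else 0) =
      agentsAt s x + (if v = x then 1 else 0) := by
  cases b <;> simp only [agentsAt, moveTo, pos, if_true, Bool.false_eq_true, if_false] <;> omega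

lemma markSum_upd [Fintype V] (g : Mk → ℕ) (μ : V → V → Mk) (u v : V) (c : Mk) (x : V) :
    markSum g (upd μ u v c) x + (if u = x then g (μ u v) else 0) =
      markSum g μ x + (if u = x then g c else 0) := by
  by_cases h : u = x
  · subst h
    have h1 := Finset.add_sum_erase Finset.univ (fun w => g (upd μ u v c u w))
      (Finset.mem_univ v)
    have h2 := Finset.add_sum_erase Finset.univ (fun w => g (μ u w)) (Finset.mem_univ v)
    have h3 : ∑ w ∈ Finset.univ.erase v, g (upd μ u v c u w) =
        ∑ w ∈ Finset.univ.erase v, g (μ u w) :=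
      Finset.sum_congr rfl fun w hw => by simp [upd, Finset.ne_of_mem_erase hw]
    have h4 : upd μ u v c u v = c := by simp [upd]
    simp only [h4] at h1
    simp only [markSum, if_true]
    omega
  · have h' : x ≠ u := fun e => h e.symm
    simp [markSum, upd, h, h']

lemma markSum_updEdge [Fintype V] (g : Mk → ℕ) (μ : V → V → Mk) {u v : V} (huv : u ≠ v)
    (c d : Mk) (x : V) :
    markSum g (updEdge μ u v c d) x +
        ((if u = x then g (μ u v) else 0) + (if v = x then g (μ v u) else 0)) =
      markSum g μ x + ((if u = x then g c else 0) + (if v = x then g d else 0)) := by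
  have h1 := markSum_upd g μ u v c x
  have h2 := markSum_upd g (upd μ u v c) v u d x
  have h3 : upd μ u v c v u = μ v u := by simp [upd, huv.symm]
  rw [h3] at h2
  unfold updEdge
  omega

lemma updEdge_apply {μ : V → V → Mk} {u v : V} (huv : u ≠ v) (c d : Mk) (x y : V) :
    updEdge μ u v c d x y =
      if x = u ∧ y = v then c else if x = v ∧ y = u then d else μ x y := by
  unfold updEdge upd
  grind

/-- What a move along the dart `(u, v)` can do: the markers before and after, the visited set
afterwards, and the absence of other markers where a rule requires it. -/
def Change (G : SimpleGraph V) (s : St V) (u v : V) (c d : Mk) (W : Set V) : Prop :=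
  (s.μ u v = .B ∧ s.μ v u = .E ∧ c = .D ∧ d = .D ∧ W = s.vis) ∨
  ((∀ w, G.Adj u w → s.μ u w ≠ .B) ∧
    ((s.μ u v = .none ∧ s.μ v u = .none ∧ c = .E ∧ d = .F ∧ v ∉ s.vis ∧ W = insert v s.vis) ∨
    (s.μ u v = .none ∧ s.μ v u = .none ∧ c = .E ∧ d = .B ∧ v ∈ s.vis ∧ W = s.vis) ∨
    ((∀ w, G.Adj u w → s.μ u w ≠ .none) ∧ s.μ u v = .F ∧ s.μ v u = .E ∧
      c = .D ∧ d = .D ∧ W = s.vis) ∨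
    ((∀ w, G.Adj u w → s.μ u w ≠ .none) ∧ s.μ u v = .E ∧ (s.μ v u = .F ∨ s.μ v u = .B) ∧
      c = .D ∧ d = .D ∧ W = s.vis)))

lemma Step.exists_change {G : SimpleGraph V} {s s' : St V} {l : Bool × (V × V)}
    (h : Step G s l s') (hs : ∀ x y, (s.μ x y).Compat (s.μ y x)) :
    ∃ b v c d W, G.Adj (pos s b) v ∧ l.2 = (pos s b, v) ∧
      s' = moveTo s b v (updEdge s.μ (pos s b) v c d) W ∧ Change G s (pos s b) v c d W := by
  cases h with
  | r1 b v hadj hB =>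
    refine ⟨b, v, _, _, _, hadj, rfl, rfl, Or.inl ⟨hB, ?_, rfl, rfl, rfl⟩⟩
    have := hs (pos s b) v
    rw [hB] at this
    revert this
    cases s.μ v (pos s b) <;> simp [Mk.Compat]
  | r2 b v hadj _ h0 hE =>
    have := hs (pos s b) v
    rw [h0, hE] at this
    exact this.elim
  | r3_new b v hadj hnoB _ h0 hv =>
    refine ⟨b, v, _, _, _, hadj, rfl, rfl, Or.inr ⟨hnoB, Or.inl ⟨h0, ?_, rfl, rfl, hv, rfl⟩⟩⟩
    have := hs (pos s b) v
    rw [h0] at this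
    revert this
    cases s.μ v (pos s b) <;> simp [Mk.Compat]
  | r3_old b v hadj hnoB _ h0 hv =>
    refine ⟨b, v, _, _, _, hadj, rfl, rfl,
      Or.inr ⟨hnoB, Or.inr (Or.inl ⟨h0, ?_, rfl, rfl, hv, Set.insert_eq_of_mem hv⟩)⟩⟩
    have := hs (pos s b) v
    rw [h0] at this
    revert this
    cases s.μ v (pos s b) <;> simp [Mk.Compat]
  | r4 b v hadj hnoB hno0 hF =>
    refine ⟨b, v, _, _, _, hadj, rfl, rfl,
      Or.inr ⟨hnoB, Or.inr (Or.inr (Or.inl ⟨hno0, hF, ?_, rfl, rfl, rfl⟩))⟩⟩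
    have := hs (pos s b) v
    rw [hF] at this
    revert this
    cases s.μ v (pos s b) <;> simp [Mk.Compat]
  | r5 b v hadj hnoB hno0 _ hE =>
    refine ⟨b, v, _, _, _, hadj, rfl, rfl,
      Or.inr ⟨hnoB, Or.inr (Or.inr (Or.inr ⟨hno0, hE, ?_, rfl, rfl, rfl⟩))⟩⟩
    have := hs (pos s b) v
    rw [hE] at this
    revert this
    cases s.μ v (pos s b) <;> simp [Mk.Compat]

lemma Step.adj {G : SimpleGraph V} {s s' : St V} {l : Bool × (V × V)} (h : Step G s l s') :
    G.Adj l.2.1 l.2.2 := by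
  cases h <;> assumption

lemma not_none_of_terminal {G : SimpleGraph V} {s : St V} (hmax : ∀ l s', ¬ Step G s l s')
    (b : Bool) {w : V} (hw : G.Adj (pos s b) w) : s.μ (pos s b) w ≠ .none := by
  intro h0
  have hnoB : ∀ w, G.Adj (pos s b) w → s.μ (pos s b) w ≠ .B :=
    fun v hv hB => hmax _ _ (.r1 s b v hv hB)
  have hnoRev : ∀ w, G.Adj (pos s b) w → ¬(s.μ (pos s b) w = .none ∧ s.μ w (pos s b) = .E) :=
    fun v hv h => hmax _ _ (.r2 s b v hv hnoB h.1 h.2)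
  by_cases hv : w ∈ s.vis
  · exact hmax _ _ (.r3_old s b w hw hnoB hnoRev h0 hv)
  · exact hmax _ _ (.r3_new s b w hw hnoB hnoRev h0 hv)

lemma eq_done_of_terminal {G : SimpleGraph V} {s : St V} (hmax : ∀ l s', ¬ Step G s l s')
    (b : Bool) {w : V} (hw : G.Adj (pos s b) w) : s.μ (pos s b) w = .D := by
  have hnoB : ∀ w, G.Adj (pos s b) w → s.μ (pos s b) w ≠ .B :=
    fun v hv hB => hmax _ _ (.r1 s b v hv hB)
  have hno0 : ∀ w, G.Adj (pos s b) w → s.μ (pos s b) w ≠ .none :=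
    fun v hv => not_none_of_terminal hmax b hv
  have hnoF : ∀ w, G.Adj (pos s b) w → s.μ (pos s b) w ≠ .F :=
    fun v hv hF => hmax _ _ (.r4 s b v hv hnoB hno0 hF)
  have h1 := hnoB w hw
  have h2 := hno0 w hw
  have h3 := hnoF w hw
  have h4 : s.μ (pos s b) w ≠ .E := fun hE => hmax _ _ (.r5 s b w hw hnoB hno0 hnoF hE)
  revert h1 h2 h3 h4
  cases s.μ (pos s b) w <;> simp

lemma edgeCount_succ (lbl : ℕ → Bool × (V × V)) (i : ℕ) (x y : V) :
    edgeCount lbl (i + 1) x y = edgeCount lbl i x y +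
      if (lbl i).2 = (x, y) ∨ (lbl i).2 = (y, x) then 1 else 0 := by
  unfold edgeCount
  rw [Finset.range_add_one, Finset.filter_insert]
  split_ifs <;> simp

/-- Counting moves edge by edge. -/
lemma IsExec.length_eq {G : SimpleGraph V} [Fintype G.edgeSet] {r : V} {k : ℕ} {f : ℕ → St V}
    {lbl : ℕ → Bool × (V × V)} (h : IsExec G r k f lbl) {n : ℕ}
    (hn : ∀ u v, G.Adj u v → edgeCount lbl k u v = n) : k = n * G.edgeFinset.card := by
  have h1 := Finset.card_eq_sum_card_fiberwise (s := Finset.range k) (t := G.edgeFinset)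
    (f := fun j => s((lbl j).2.1, (lbl j).2.2)) fun j hj => by
      simpa using (h.2 j (by simpa using hj)).adj
  rw [Finset.card_range] at h1
  rw [h1, Finset.sum_const_nat (m := n), mul_comm]
  intro e he
  induction e with
  | h u v =>
    rw [← hn u v (by simpa using he)]
    unfold edgeCount
    congr 1
    ext j
    simp [Prod.ext_iff]

end Basic

/-- The properties shared by all reachable states. -/
structure Inv {V : Type*} [Fintype V] [DecidableEq V] (G : SimpleGraph V) (s : St V) : Prop where
  compat : ∀ x y, (s.μ x y).Compat (s.μ y x)
  adj : ∀ x y, s.μ x y ≠ .none → G.Adj x y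
  vis : ∀ x y, s.μ x y ≠ .none → x ∈ s.vis
  even : ∀ x, Even (markSum Mk.single s.μ x + agentsAt s x)
  back_le : ∀ x, markSum Mk.back s.μ x ≤ agentsAt s x
  first_le : ∀ x, markSum Mk.first s.μ x ≤ 1
  occupied : ∀ x, 0 < agentsAt s x → x ∈ s.vis
  /-- A visited vertex with an unmarked dart has an `E` or `F` dart, or more agents than
  `B` darts. -/
  unmarked : ∀ x ∈ s.vis, (∃ w, G.Adj x w ∧ s.μ x w = .none) →
    markSum Mk.back s.μ x < markSum Mk.single s.μ x ∨ markSum Mk.back s.μ x < agentsAt s x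
  /-- First entries point from later to earlier vertices. -/
  rank : ∃ t : V → ℕ, ∀ x y, s.μ x y = .F → t y < t x

section Invariant

lemma le_markSum {V : Type*} [Fintype V] (g : Mk → ℕ) (μ : V → V → Mk) (x y : V) :
    g (μ x y) ≤ markSum g μ x :=
  Finset.single_le_sum (f := fun w => g (μ x w)) (fun _ _ => Nat.zero_le _) (Finset.mem_univ y)

lemma markSum_mono {V : Type*} [Fintype V] {g h : Mk → ℕ} (hgh : ∀ m, g m ≤ h m)
    (μ : V → V → Mk) (x : V) : markSum g μ x ≤ markSum h μ x :=
  Finset.sum_le_sum fun _ _ => hgh _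

variable {V : Type*} [Fintype V] [DecidableEq V] {G : SimpleGraph V}

lemma inv_init (r : V) : Inv G (init r) where
  compat _ _ := trivial
  adj _ _ h := (h rfl).elim
  vis _ _ h := (h rfl).elim
  even x := by
    by_cases h : r = x <;> simp [markSum, init, Mk.single, agentsAt, h]
  back_le x := by simp [markSum, init, Mk.back]
  first_le x := by simp [markSum, init, Mk.first]
  occupied x hx := by
    by_contra hne
    have : r ≠ x := fun e => hne e.symm
    simp [init, agentsAt, this] at hx
  unmarked x hx _ := by
    right
    have : r = x := hx.symm
    simp [markSum, init, Mk.back, agentsAt, this]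
  rank := ⟨fun _ => 0, fun _ _ h => by simp [init] at h⟩

lemma Inv.step {s s' : St V} {l : Bool × (V × V)} (hs : Inv G s) (h : Step G s l s') :
    Inv G s' := by
  obtain ⟨b, v, c, d, W, hadj, -, rfl, hc⟩ := h.exists_change hs.compat
  have hA := agentsAt_moveTo s b v (updEdge s.μ (pos s b) v c d) W
  generalize hu : pos s b = u at *
  have huv : u ≠ v := hadj.ne
  have hμ : ∀ x y, (moveTo s b v (updEdge s.μ u v c d) W).μ x y =
      if x = u ∧ y = v then c else if x = v ∧ y = u then d else s.μ x y :=
    updEdge_apply huv c d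
  have hvis : (moveTo s b v (updEdge s.μ u v c d) W).vis = W := rfl
  have hS := markSum_updEdge Mk.single s.μ huv c d
  have hB := markSum_updEdge Mk.back s.μ huv c d
  have hF := markSum_updEdge Mk.first s.μ huv c d
  have hsum : ∀ g, markSum g (moveTo s b v (updEdge s.μ u v c d) W).μ =
    markSum g (updEdge s.μ u v c d) := fun _ => rfl
  have hbs := markSum_mono (g := Mk.back) (h := Mk.single) (by rintro ⟨⟩ <;> decide) s.μ
  have hnew : ∀ x, x ∉ s.vis → ∀ y, s.μ x y = .none := fun x hx y => by
    by_contra hne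
    exact hx (hs.vis x y hne)
  have hB0 : (∀ w, G.Adj u w → s.μ u w ≠ .B) → markSum Mk.back s.μ u = 0 := fun h0 =>
    Finset.sum_eq_zero fun y _ => by
      by_cases hy : G.Adj u y
      · have := h0 y hy
        revert this
        cases s.μ u y <;> simp [Mk.back]
      · have : s.μ u y = .none := by
          by_contra hne
          exact hy (hs.adj u y hne)
        rw [this]
        rfl
  have hnewF : v ∉ s.vis → markSum Mk.first s.μ v = 0 := fun hv =>
    Finset.sum_eq_zero fun y _ => by rw [hnew v hv y]; rfl
  have huA : 0 < agentsAt s u := by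
    rw [← hu]
    cases b <;> simp [agentsAt, pos]
  have huvis : u ∈ s.vis := hs.occupied u huA
  have hW : ∀ x, x ∈ W ↔ x = v ∨ x ∈ s.vis := by
    have := hs.vis v u
    unfold Change at hc
    grind
  have hcd : c.Compat d ∧ d.Compat c ∧ c ≠ .none ∧ d ≠ .none ∧ c ≠ .F := by
    unfold Change at hc
    rcases hc with h | ⟨-, h | h | h | h⟩ <;> grind [Mk.Compat]
  obtain ⟨hcd, hdc, hc0, hd0, hcF⟩ := hcd
  generalize hs' : moveTo s b v (updEdge s.μ u v c d) W = s' at *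
  refine ⟨fun x y => ?_, fun x y hxy => ?_, fun x y hxy => ?_, fun x => ?_, fun x => ?_,
    fun x => ?_, fun x hx => ?_, fun x hx hw => ?_, ?_⟩
  · have := hs.compat x y
    rw [hμ, hμ]
    grind
  · have := hs.adj x y
    have := hadj.symm
    rw [hμ] at hxy
    grind
  · have := hs.vis x y
    rw [hμ] at hxy
    rw [hvis, hW]
    grind
  · have h1 := hs.even x
    have h2 := hS x
    have h3 := hA x
    rw [hsum, Nat.even_iff]
    rw [Nat.even_iff] at h1
    unfold Change at hc
    rcases hc with ⟨h4, h5, rfl, rfl, -⟩ | ⟨-, ⟨h4, h5, rfl, rfl, -⟩ | ⟨h4, h5, rfl, rfl, -⟩ |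
      ⟨-, h4, h5, rfl, rfl, -⟩ | ⟨-, h4, h5 | h5, rfl, rfl, -⟩⟩ <;>
    simp only [h4, h5, Mk.single] at h2 <;> split_ifs at h2 h3 <;> omega
  · have h1 := hs.back_le x
    have h2 := hB x
    have h3 := hA x
    rw [hsum]
    unfold Change at hc
    rcases hc with ⟨h4, h5, rfl, rfl, -⟩ | ⟨h0, ⟨h4, h5, rfl, rfl, -⟩ | ⟨h4, h5, rfl, rfl, -⟩ |
      ⟨-, h4, h5, rfl, rfl, -⟩ | ⟨-, h4, h5 | h5, rfl, rfl, -⟩⟩ <;>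
    simp only [h4, h5, Mk.back] at h2 <;> try have h6 := hB0 h0
    all_goals
      by_cases hxu : u = x
      · subst hxu
        simp only [huv.symm, if_true, if_false] at h2 h3
        omega
      · simp only [hxu, if_false] at h2 h3
        split_ifs at h2 h3 <;> omega
  · have h1 := hs.first_le x
    have h2 := hF x
    rw [hsum]
    unfold Change at hc
    rcases hc with ⟨h4, h5, rfl, rfl, -⟩ | ⟨-, ⟨h4, h5, rfl, rfl, hv, -⟩ |
      ⟨h4, h5, rfl, rfl, -⟩ | ⟨-, h4, h5, rfl, rfl, -⟩ | ⟨-, h4, h5 | h5, rfl, rfl, -⟩⟩ <;>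
    simp only [h4, h5, Mk.first] at h2 <;> try have h6 := hnewF hv
    all_goals
      by_cases hxv : v = x
      · subst hxv
        simp only [huv, if_true, if_false] at h2
        omega
      · simp only [hxv, if_false] at h2
        split_ifs at h2 <;> omega
  · have h1 := hs.occupied x
    have h3 := hA x
    rw [hvis, hW]
    by_cases hxv : v = x
    · exact Or.inl hxv.symm
    · refine Or.inr (h1 ?_)
      simp only [hxv, if_false] at h3
      omega
  · rw [hvis, hW] at hx
    obtain ⟨w, hw, hw0⟩ := hw
    rw [hμ] at hw0
    have hw1 : s.μ x w = .none := by grind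
    have h1 : x ∈ s.vis → _ := fun h => hs.unmarked x h ⟨w, hw, hw1⟩
    have h2 := hB x
    have h3 := hA x
    have h7 := hS x
    have h8 := hbs x
    have h9 := hs.back_le x
    rw [hsum, hsum]
    unfold Change at hc
    rcases hc with ⟨h4, h5, rfl, rfl, -⟩ | ⟨h0, ⟨h4, h5, rfl, rfl, -⟩ |
      ⟨h4, h5, rfl, rfl, hv, -⟩ | ⟨hn, h4, h5, rfl, rfl, -⟩ |
      ⟨hn, h4, h5 | h5, rfl, rfl, -⟩⟩ <;>
    simp only [h4, h5, Mk.back, Mk.single] at h2 h7 <;>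
    (by_cases hxu : u = x
     · subst hxu
       simp only [huv.symm, if_true, if_false] at h2 h3 h7
       have h1 := h1 huvis
       first
         | omega
         | exact (hn w hw hw1).elim
     · by_cases hxv : v = x
       · subst hxv
         simp only [hxu, if_true, if_false] at h2 h3 h7
         first
           | omega
           | have h1 := h1 hv
             omega
       · have h1 := h1 (hx.resolve_left fun e => hxv e.symm)
         simp only [hxu, hxv, if_false] at h2 h3 h7
         omega)
  · obtain ⟨t, ht⟩ := hs.rank
    by_cases hF' : d = .F
    · have hv : v ∉ s.vis := by
        unfold Change at hc
        grind
      have hvn := hnew v hv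
      refine ⟨fun x => if x = v then t u + 1 else t x, fun x y hxy => ?_⟩
      rw [hμ] at hxy
      have := ht x y
      have hxy' := hs.compat x y
      by_cases hx : x = v
      · subst hx
        by_cases hy : y = u
        · subst hy
          simp [huv]
        · simp [hy, hvn] at hxy
          grind
      · by_cases hy : y = v
        · subst hy
          rw [hvn] at hxy'
          have : s.μ x y ≠ .F := fun e => by simp [e, Mk.Compat] at hxy'
          grind
        · simp only [hx, hy, if_false]
          grind
    · refine ⟨t, fun x y hxy => ht x y ?_⟩
      rw [hμ] at hxy
      grind

lemma Inv.single_eq_zero_of_terminal {s : St V} (hs : Inv G s)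
    (hmax : ∀ l s', ¬ Step G s l s') (b : Bool) : markSum Mk.single s.μ (pos s b) = 0 :=
  Finset.sum_eq_zero fun w _ => by
    by_cases hw : G.Adj (pos s b) w
    · rw [eq_done_of_terminal hmax b hw]
      rfl
    · have : s.μ (pos s b) w = .none := by
        by_contra hne
        exact hw (hs.adj _ w hne)
      rw [this]
      rfl

lemma Inv.colocated_of_terminal {s : St V} (hs : Inv G s)
    (hmax : ∀ l s', ¬ Step G s l s') : s.p1 = s.p2 := by
  by_contra hne
  have h1 := hs.single_eq_zero_of_terminal hmax true
  have h2 := hs.even (pos s true)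
  rw [h1] at h2
  simp [agentsAt, pos, Ne.symm hne] at h2

lemma Inv.back_eq_zero_of_terminal {s : St V} (hs : Inv G s)
    (hmax : ∀ l s', ¬ Step G s l s') (x : V) : markSum Mk.back s.μ x = 0 := by
  by_cases hx : pos s true = x
  · have h1 := hs.single_eq_zero_of_terminal hmax true
    have h2 := markSum_mono (g := Mk.back) (h := Mk.single) (by rintro ⟨⟩ <;> decide) s.μ x
    rw [hx] at h1
    omega
  · have h1 := hs.back_le x
    have h2 := hs.colocated_of_terminal hmax
    have h3 : s.p1 ≠ x := hx
    simp only [agentsAt, ← h2, h3, if_false] at h1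
    omega

/-- In a terminal state the edges traversed once form a forest without vertices of odd degree,
hence there are none. -/
lemma Inv.no_single_of_terminal {s : St V} (hs : Inv G s)
    (hmax : ∀ l s', ¬ Step G s l s') (x : V) : markSum Mk.single s.μ x = 0 := by
  obtain ⟨t, ht⟩ := hs.rank
  by_contra hx
  obtain ⟨y, hy, hmaxy⟩ := Finset.exists_max_image
    (Finset.univ.filter fun x => markSum Mk.single s.μ x ≠ 0) t ⟨x, by simpa using hx⟩
  replace hy : markSum Mk.single s.μ y ≠ 0 := by simpa using hy
  have hnoB : ∀ x w, s.μ x w ≠ .B := fun x w h => by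
    have h1 := le_markSum Mk.back s.μ x w
    rw [hs.back_eq_zero_of_terminal hmax, h] at h1
    simp [Mk.back] at h1
  have hnoE : ∀ w, s.μ y w ≠ .E := fun w h => by
    have h1 := hs.compat y w
    have h2 : s.μ w y = .F := by
      have h3 := hnoB w y
      rw [h] at h1
      revert h1 h3
      cases s.μ w y <;> simp [Mk.Compat]
    have h4 := le_markSum Mk.single s.μ w y
    rw [h2] at h4
    simp only [Mk.single] at h4
    have h5 := hmaxy w (by simp; omega)
    have h6 := ht w y h2
    omega
  have hsf : markSum Mk.single s.μ y = markSum Mk.first s.μ y :=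
    Finset.sum_congr rfl fun w _ => by
      have h1 := hnoB y w
      have h2 := hnoE w
      revert h1 h2
      cases s.μ y w <;> simp [Mk.single, Mk.first]
  have h1 := hs.first_le y
  have h2 := hs.even y
  have h3 := hs.colocated_of_terminal hmax
  rw [Nat.even_iff] at h2
  simp only [agentsAt, ← h3] at h2
  split_ifs at h2 <;> omega

lemma Inv.done_of_terminal {s : St V} (hs : Inv G s) (hG : G.Connected)
    (hmax : ∀ l s', ¬ Step G s l s') {x y : V} (hxy : G.Adj x y) : s.μ x y = .D := by
  have hvis : ∀ x ∈ s.vis, ∀ y, G.Adj x y → s.μ x y = .D := fun x hx y hxy => by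
    have h1 := hs.no_single_of_terminal hmax x
    have h2 := hs.back_eq_zero_of_terminal hmax x
    have h3 : s.μ x y ≠ .none := fun h0 => by
      have h4 := hs.unmarked x hx ⟨y, hxy, h0⟩
      have h5 : s.p1 = x := by
        by_contra hne
        simp only [agentsAt, ← hs.colocated_of_terminal hmax, hne, if_false] at h4
        omega
      subst h5
      exact not_none_of_terminal hmax true hxy h0
    have h6 := le_markSum Mk.single s.μ x y
    rw [h1] at h6
    revert h3 h6
    cases s.μ x y <;> simp [Mk.single]
  have hall : ∀ z, z ∈ s.vis := fun z => by
    have hreach := hG.preconnected s.p1 z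
    rw [SimpleGraph.reachable_iff_reflTransGen] at hreach
    induction hreach with
    | refl => exact hs.occupied _ (by simp [agentsAt])
    | @tail a b _ hadj ih =>
      refine hs.vis b a fun h0 => ?_
      have h1 := hs.compat a b
      rw [hvis a ih b hadj, h0] at h1
      exact h1
  exact hvis x (hall x) y hxy

lemma Inv.weight_step {s s' : St V} {l : Bool × (V × V)} (hs : Inv G s) (h : Step G s l s')
    (x y : V) : (s'.μ x y).weight =
      (s.μ x y).weight + if l.2 = (x, y) ∨ l.2 = (y, x) then 1 else 0 := by
  obtain ⟨b, v, c, d, W, hadj, hl, rfl, hc⟩ := h.exists_change hs.compat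
  rw [hl]
  generalize pos s b = u at *
  have hμ : (moveTo s b v (updEdge s.μ u v c d) W).μ x y =
      if x = u ∧ y = v then c else if x = v ∧ y = u then d else s.μ x y :=
    updEdge_apply hadj.ne c d x y
  rw [hμ]
  simp only [Prod.mk.injEq]
  unfold Change at hc
  have := hadj.ne
  rcases hc with h | ⟨-, h | h | h | h⟩ <;> grind [Mk.weight]

lemma IsExec.inv {r : V} {k : ℕ} {f : ℕ → St V} {lbl : ℕ → Bool × (V × V)}
    (h : IsExec G r k f lbl) {i : ℕ} (hi : i ≤ k) : Inv G (f i) := by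
  induction i with
  | zero => exact h.1 ▸ inv_init r
  | succ i ih => exact (ih (by omega)).step (h.2 i (by omega))

lemma IsExec.edgeCount_eq {r : V} {k : ℕ} {f : ℕ → St V} {lbl : ℕ → Bool × (V × V)}
    (h : IsExec G r k f lbl) (x y : V) {i : ℕ} (hi : i ≤ k) :
    edgeCount lbl i x y = ((f i).μ x y).weight := by
  induction i with
  | zero => simp [h.1, edgeCount, init, Mk.weight]
  | succ i ih =>
    rw [edgeCount_succ, ih (by omega), (h.inv (by omega)).weight_step (h.2 i (by omega))]

end Invariant

end TwoExplore

open TwoExplore in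
/-- Every maximal asynchronous execution of the two-agent
exploration algorithm consists of exactly `2 * m` moves; at termination every
edge has been traversed exactly twice and the agents are co-located. -/
theorem two_agent_async_exploration {V : Type*} [Fintype V] [DecidableEq V]
    (G : SimpleGraph V) [Fintype G.edgeSet] (hG : G.Connected) (r : V)
    (k : ℕ) (f : ℕ → St V) (lbl : ℕ → Bool × (V × V))
    (hexec : IsExec G r k f lbl)
    (hmax : ∀ l s', ¬ Step G (f k) l s') :
    k = 2 * G.edgeFinset.card ∧
    (∀ u v : V, G.Adj u v → edgeCount lbl k u v = 2) ∧
    (f k).p1 = (f k).p2 := by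
  have hinv := hexec.inv le_rfl
  have hcount : ∀ u v : V, G.Adj u v → edgeCount lbl k u v = 2 := fun u v huv => by
    rw [hexec.edgeCount_eq u v le_rfl, hinv.done_of_terminal hG hmax huv]
    rfl
  exact ⟨hexec.length_eq hcount, hcount, hinv.colocated_of_terminal hmax⟩
end

section
/- In every state reached along an asynchronous execution of the rendezvous algorithm: every edge with both darts marked ∅ has never been traversed; every edge with some dart marked in {B_A, E_A, F_A, B_T, E_T, F_T} has been traversed exactly once; every edge with some dart marked in {E_AT, F_AT, D} has been traversed exactly twice; every edge with some dart marked in {E_ATT, F_ATT, D′} has been traversed exactly three times. Consequently no edge is ever traversed more than three times. -/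
/-!
Asynchronous rendezvous of two distinguishable agents, Ariadne (starting at
`a`) and Theseus (starting at `t`).  Markers as in the paper; `Dp` denotes
the marker `D′`.  A state records the marking, the two positions and the two
visited sets.  The process stops as soon as the agents are co-located.
-/

namespace Rdv

inductive Mk : Type
  | none | EA | BA | FA | ET | BT | FT | EAT | FAT | EATT | FATT | D | Dp
  deriving DecidableEq

/-- The two agents: `A` = Ariadne, `T` = Theseus. -/
inductive Ag : Type
  | A | T
  deriving DecidableEq

structure St (V : Type*) where
  μ : V → V → Mk
  pA : V
  pT : V
  visA : Set V
  visT : Set V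

variable {V : Type*} [DecidableEq V]

/-- Update the marker of the dart `(u, v)`. -/
def upd (μ : V → V → Mk) (u v : V) (c : Mk) : V → V → Mk :=
  fun a b => if a = u ∧ b = v then c else μ a b

/-- One move of one of the agents, applying the first applicable rule of its
navigation table; the label records the agent and the traversed dart. -/
inductive RStep (G : SimpleGraph V) : St V → Ag × (V × V) → St V → Prop
  | th1 (s : St V) (v : V) (hadj : G.Adj s.pT v)
      (h : s.μ s.pT v = Mk.BT) :
      RStep G s (Ag.T, (s.pT, v))
        ⟨upd (upd s.μ s.pT v Mk.D) v s.pT Mk.D, s.pA, v, s.visA, s.visT⟩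
  | th2 (s : St V) (v : V) (hadj : G.Adj s.pT v)
      (hnBT : ∀ w, G.Adj s.pT w → s.μ s.pT w ≠ Mk.BT)
      (h : s.μ s.pT v = Mk.EA) :
      RStep G s (Ag.T, (s.pT, v))
        ⟨upd (upd s.μ s.pT v Mk.EAT) v s.pT Mk.FAT, s.pA, v, s.visA, s.visT⟩
  | th3 (s : St V) (v : V) (hadj : G.Adj s.pT v)
      (hnBT : ∀ w, G.Adj s.pT w → s.μ s.pT w ≠ Mk.BT)
      (hnEA : ∀ w, G.Adj s.pT w → s.μ s.pT w ≠ Mk.EA)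
      (h : s.μ s.pT v = Mk.EAT) :
      RStep G s (Ag.T, (s.pT, v))
        ⟨upd (upd s.μ s.pT v Mk.EATT) v s.pT Mk.FATT, s.pA, v, s.visA, s.visT⟩
  | th4_new (s : St V) (v : V) (hadj : G.Adj s.pT v)
      (hnBT : ∀ w, G.Adj s.pT w → s.μ s.pT w ≠ Mk.BT)
      (hnEA : ∀ w, G.Adj s.pT w → s.μ s.pT w ≠ Mk.EA)
      (hnEAT : ∀ w, G.Adj s.pT w → s.μ s.pT w ≠ Mk.EAT)
      (h : s.μ s.pT v = Mk.none) (hv : v ∉ s.visT) :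
      RStep G s (Ag.T, (s.pT, v))
        ⟨upd (upd s.μ s.pT v Mk.ET) v s.pT Mk.FT, s.pA, v, s.visA,
          insert v s.visT⟩
  | th4_old (s : St V) (v : V) (hadj : G.Adj s.pT v)
      (hnBT : ∀ w, G.Adj s.pT w → s.μ s.pT w ≠ Mk.BT)
      (hnEA : ∀ w, G.Adj s.pT w → s.μ s.pT w ≠ Mk.EA)
      (hnEAT : ∀ w, G.Adj s.pT w → s.μ s.pT w ≠ Mk.EAT)
      (h : s.μ s.pT v = Mk.none) (hv : v ∈ s.visT) :
      RStep G s (Ag.T, (s.pT, v))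
        ⟨upd (upd s.μ s.pT v Mk.ET) v s.pT Mk.BT, s.pA, v, s.visA,
          insert v s.visT⟩
  | th5 (s : St V) (v : V) (hadj : G.Adj s.pT v)
      (hnBT : ∀ w, G.Adj s.pT w → s.μ s.pT w ≠ Mk.BT)
      (hnEA : ∀ w, G.Adj s.pT w → s.μ s.pT w ≠ Mk.EA)
      (hnEAT : ∀ w, G.Adj s.pT w → s.μ s.pT w ≠ Mk.EAT)
      (hn0 : ∀ w, G.Adj s.pT w → s.μ s.pT w ≠ Mk.none)
      (h : s.μ s.pT v = Mk.FT) :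
      RStep G s (Ag.T, (s.pT, v))
        ⟨upd (upd s.μ s.pT v Mk.D) v s.pT Mk.D, s.pA, v, s.visA, s.visT⟩
  | ar1 (s : St V) (v : V) (hadj : G.Adj s.pA v)
      (h : s.μ s.pA v = Mk.BA) :
      RStep G s (Ag.A, (s.pA, v))
        ⟨upd (upd s.μ s.pA v Mk.D) v s.pA Mk.D, v, s.pT, s.visA, s.visT⟩
  | ar2 (s : St V) (v : V) (hadj : G.Adj s.pA v)
      (hnBA : ∀ w, G.Adj s.pA w → s.μ s.pA w ≠ Mk.BA)
      (h : s.μ s.pA v = Mk.ET) :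
      RStep G s (Ag.A, (s.pA, v))
        ⟨upd (upd s.μ s.pA v Mk.EAT) v s.pA Mk.FAT, v, s.pT, s.visA, s.visT⟩
  | ar3 (s : St V) (v : V) (hadj : G.Adj s.pA v)
      (hnBA : ∀ w, G.Adj s.pA w → s.μ s.pA w ≠ Mk.BA)
      (hnET : ∀ w, G.Adj s.pA w → s.μ s.pA w ≠ Mk.ET)
      (h : s.μ s.pA v = Mk.FAT) :
      RStep G s (Ag.A, (s.pA, v))
        ⟨upd (upd s.μ s.pA v Mk.Dp) v s.pA Mk.Dp, v, s.pT, s.visA, s.visT⟩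
  | ar4_new (s : St V) (v : V) (hadj : G.Adj s.pA v)
      (hnBA : ∀ w, G.Adj s.pA w → s.μ s.pA w ≠ Mk.BA)
      (hnET : ∀ w, G.Adj s.pA w → s.μ s.pA w ≠ Mk.ET)
      (hnFAT : ∀ w, G.Adj s.pA w → s.μ s.pA w ≠ Mk.FAT)
      (h : s.μ s.pA v = Mk.none) (hv : v ∉ s.visA) :
      RStep G s (Ag.A, (s.pA, v))
        ⟨upd (upd s.μ s.pA v Mk.EA) v s.pA Mk.FA, v, s.pT,
          insert v s.visA, s.visT⟩
  | ar4_old (s : St V) (v : V) (hadj : G.Adj s.pA v)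
      (hnBA : ∀ w, G.Adj s.pA w → s.μ s.pA w ≠ Mk.BA)
      (hnET : ∀ w, G.Adj s.pA w → s.μ s.pA w ≠ Mk.ET)
      (hnFAT : ∀ w, G.Adj s.pA w → s.μ s.pA w ≠ Mk.FAT)
      (h : s.μ s.pA v = Mk.none) (hv : v ∈ s.visA) :
      RStep G s (Ag.A, (s.pA, v))
        ⟨upd (upd s.μ s.pA v Mk.EA) v s.pA Mk.BA, v, s.pT,
          insert v s.visA, s.visT⟩
  | ar5 (s : St V) (v : V) (hadj : G.Adj s.pA v)
      (hnBA : ∀ w, G.Adj s.pA w → s.μ s.pA w ≠ Mk.BA)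
      (hnET : ∀ w, G.Adj s.pA w → s.μ s.pA w ≠ Mk.ET)
      (hnFAT : ∀ w, G.Adj s.pA w → s.μ s.pA w ≠ Mk.FAT)
      (hn0 : ∀ w, G.Adj s.pA w → s.μ s.pA w ≠ Mk.none)
      (h : s.μ s.pA v = Mk.FA) :
      RStep G s (Ag.A, (s.pA, v))
        ⟨upd (upd s.μ s.pA v Mk.D) v s.pA Mk.D, v, s.pT, s.visA, s.visT⟩

/-- The initial state: Ariadne at `a`, Theseus at `t`. -/
def init (a t : V) : St V := ⟨fun _ _ => Mk.none, a, t, {a}, {t}⟩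

/-- `f 0, …, f k` is an asynchronous execution of the rendezvous algorithm:
at each round the agents are not yet co-located and the adversarially chosen
agent `(lbl i).1` moves, traversing the dart `(lbl i).2`. -/
def IsExec (G : SimpleGraph V) (a t : V) (k : ℕ) (f : ℕ → St V)
    (lbl : ℕ → Ag × (V × V)) : Prop :=
  f 0 = init a t ∧
  ∀ i < k, (f i).pA ≠ (f i).pT ∧ RStep G (f i) (lbl i) (f (i + 1))

/-- Number of times the edge `{u, v}` has been traversed (in either direction)
during the first `i` moves. -/
def edgeCount (lbl : ℕ → Ag × (V × V)) (i : ℕ) (u v : V) : ℕ :=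
  ((Finset.range i).filter fun j => (lbl j).2 = (u, v) ∨ (lbl j).2 = (v, u)).card

end Rdv

namespace Rdv

/-- The number of traversals of an edge that a marker on one of its darts records. -/
def Mk.weight : Mk → ℕ
  | none => 0
  | EA | BA | FA | ET | BT | FT => 1
  | EAT | FAT | D => 2
  | EATT | FATT | Dp => 3

theorem Mk.weight_le_three (c : Mk) : c.weight ≤ 3 := by
  cases c <;> decide

variable {V : Type*} [DecidableEq V]

theorem RStep.exists_marking_eq {G : SimpleGraph V} {s s' : St V} {l : Ag × (V × V)}
    (h : RStep G s l s') :
    ∃ c d : Mk, s'.μ = upd (upd s.μ l.2.1 l.2.2 c) l.2.2 l.2.1 d ∧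
      c.weight = (s.μ l.2.1 l.2.2).weight + 1 ∧ d.weight = (s.μ l.2.1 l.2.2).weight + 1 := by
  cases h <;> exact ⟨_, _, rfl, by simp [*, Mk.weight], by simp [*, Mk.weight]⟩

theorem edgeCount_comm (lbl : ℕ → Ag × (V × V)) (i : ℕ) (u v : V) :
    edgeCount lbl i u v = edgeCount lbl i v u := by
  simp only [edgeCount, or_comm]

theorem edgeCount_succ (lbl : ℕ → Ag × (V × V)) (i : ℕ) (u v : V) :
    edgeCount lbl (i + 1) u v = edgeCount lbl i u v +
      if (lbl i).2 = (u, v) ∨ (lbl i).2 = (v, u) then 1 else 0 := by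
  unfold edgeCount
  rw [Finset.range_add_one, Finset.filter_insert]
  split_ifs <;> simp

theorem IsExec.weight_eq_edgeCount {G : SimpleGraph V} {a t : V} {k : ℕ} {f : ℕ → St V}
    {lbl : ℕ → Ag × (V × V)} (h : IsExec G a t k f lbl) {i : ℕ} (hi : i ≤ k) (u v : V) :
    ((f i).μ u v).weight = edgeCount lbl i u v := by
  induction i generalizing u v with
  | zero => simp [h.1, init, edgeCount, Mk.weight]
  | succ i ih =>
    specialize ih (by omega)
    obtain ⟨c, d, hμ, hc, hd⟩ := (h.2 i hi).2.exists_marking_eq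
    rw [ih] at hc hd
    rw [edgeCount_succ, hμ]
    clear hμ
    generalize (lbl i).2 = e at hc hd ⊢
    obtain ⟨x, y⟩ := e
    simp only [upd, Prod.mk.injEq] at hc hd ⊢
    split_ifs <;> grind [edgeCount_comm]

end Rdv

open Rdv in
/-- Along any asynchronous execution of the rendezvous
algorithm: edges with both darts unmarked were never traversed; edges with a
dart marked in `{B_A, E_A, F_A, B_T, E_T, F_T}` were traversed exactly once;
edges with a dart in `{E_AT, F_AT, D}` exactly twice; edges with a dart in
`{E_ATT, F_ATT, D′}` exactly three times.  Consequently no edge is ever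
traversed more than three times. -/
theorem rendezvous_edge_invariant {V : Type*} [Fintype V] [DecidableEq V]
    (G : SimpleGraph V) [Fintype G.edgeSet] (hG : G.Connected)
    (a t : V) (hat : a ≠ t)
    (k : ℕ) (f : ℕ → St V) (lbl : ℕ → Ag × (V × V))
    (hexec : IsExec G a t k f lbl) :
    ∀ i ≤ k, ∀ u v : V, G.Adj u v →
      (((f i).μ u v = Mk.none ∧ (f i).μ v u = Mk.none) →
        edgeCount lbl i u v = 0) ∧
      (((f i).μ u v = Mk.BA ∨ (f i).μ u v = Mk.EA ∨ (f i).μ u v = Mk.FA ∨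
        (f i).μ u v = Mk.BT ∨ (f i).μ u v = Mk.ET ∨ (f i).μ u v = Mk.FT) →
        edgeCount lbl i u v = 1) ∧
      (((f i).μ u v = Mk.EAT ∨ (f i).μ u v = Mk.FAT ∨ (f i).μ u v = Mk.D) →
        edgeCount lbl i u v = 2) ∧
      (((f i).μ u v = Mk.EATT ∨ (f i).μ u v = Mk.FATT ∨ (f i).μ u v = Mk.Dp) →
        edgeCount lbl i u v = 3) ∧
      edgeCount lbl i u v ≤ 3 := by
  intro i hi u v _
  rw [← hexec.weight_eq_edgeCount hi u v]
  refine ⟨?_, ?_, ?_, ?_, Mk.weight_le_three _⟩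
  · rintro ⟨h₁, -⟩
    simp [h₁, Mk.weight]
  · rintro (h₁ | h₁ | h₁ | h₁ | h₁ | h₁) <;> simp [h₁, Mk.weight]
  · rintro (h₁ | h₁ | h₁) <;> simp [h₁, Mk.weight]
  · rintro (h₁ | h₁ | h₁) <;> simp [h₁, Mk.weight]
end

section
/- Let P be the path graph on n vertices 0, 1, …, n−1 (with n ≥ 2), whose edges join i and i+1 for 0 ≤ i < n−1. If w₁ and w₂ are walks in P that both start at vertex 0, have equal length, and are such that every edge of P is traversed by w₁ or by w₂, then the sum of the lengths of w₁ and w₂ is at least 2(n−1). In particular, two agents with equal speeds starting at one end of a line of total length L must collectively spend at least 2L to explore it. -/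
/-- A walk in a path graph of length `ℓ` starting at `u` stays among the vertices up to `u + ℓ`. -/
theorem SimpleGraph.Walk.val_le_add_length_of_mem_support_pathGraph {n : ℕ} {u v z : Fin n}
    (w : (SimpleGraph.pathGraph n).Walk u v) (hz : z ∈ w.support) :
    z.val ≤ u.val + w.length := by
  induction w with
  | nil => simp_all
  | cons h p ih =>
    rw [SimpleGraph.Walk.support_cons, List.mem_cons] at hz
    rw [SimpleGraph.Walk.length_cons]
    rw [SimpleGraph.pathGraph_adj] at h
    rcases hz with rfl | hz
    · omega
    · have := ih hz
      omega

/-- On the path graph with `n` vertices (`n ≥ 2`), two walks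
starting at the end-vertex `0`, of equal length, and jointly traversing every
edge, have total length at least `2 * (n - 1)`. -/
theorem line_exploration_lower_bound (n : ℕ) (hn : 2 ≤ n) (x y : Fin n)
    (w₁ : (SimpleGraph.pathGraph n).Walk ⟨0, by omega⟩ x)
    (w₂ : (SimpleGraph.pathGraph n).Walk ⟨0, by omega⟩ y)
    (hlen : w₁.length = w₂.length)
    (hcov : ∀ e ∈ (SimpleGraph.pathGraph n).edgeSet,
      e ∈ w₁.edges ∨ e ∈ w₂.edges) :
    2 * (n - 1) ≤ w₁.length + w₂.length := by
  have hadj : (SimpleGraph.pathGraph n).Adj ⟨n - 2, by omega⟩ ⟨n - 1, by omega⟩ := by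
    rw [SimpleGraph.pathGraph_adj]
    left
    dsimp only
    omega
  rcases hcov _ ((SimpleGraph.mem_edgeSet _).2 hadj) with h | h
  · have := w₁.val_le_add_length_of_mem_support_pathGraph (w₁.snd_mem_support_of_mem_edges h)
    dsimp only at this
    omega
  · have := w₂.val_le_add_length_of_mem_support_pathGraph (w₂.snd_mem_support_of_mem_edges h)
    dsimp only at this
    omega
end
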